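/- Let (W,S) be a Coxeter system of finite rank and let C = W_I w W_J be a minimal presentation of a parabolic double coset C. If T is any subset of M_L(C) that is connected in the Coxeter graph, then either T ⊆ I, or else T is disjoint from I, no element of T is adjacent to an element of I, and T ⊆ (w J w⁻¹) ∩ S. -/

import Mathlib

open CoxeterSystem

variable {B : Type*} {W : Type*} [Group W]

/-- The standard parabolic subgroup `W_I` of a Coxeter system, generated by the
simple reflections indexed by `I`. -/
def CoxeterSystem.parabolic {M : CoxeterMatrix B} (cs : CoxeterSystem M W) (I : Set B) :
    Subgroup W :=
  Subgroup.closure (cs.simple '' I)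

/-- The parabolic double coset `W_I w W_J`. -/
def CoxeterSystem.doubleCoset {M : CoxeterMatrix B} (cs : CoxeterSystem M W) (I : Set B)
    (w : W) (J : Set B) : Set W :=
  {x | ∃ u ∈ cs.parabolic I, ∃ v ∈ cs.parabolic J, x = u * w * v}

/-- Two simple reflections are adjacent in the Coxeter graph if they are distinct and
do not commute. -/
def CoxeterSystem.adjacent {M : CoxeterMatrix B} (cs : CoxeterSystem M W) (s t : B) : Prop :=
  s ≠ t ∧ cs.simple s * cs.simple t ≠ cs.simple t * cs.simple s

/-- The connected component of `i` in the subgraph of the Coxeter graph induced by `I`. -/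
def CoxeterSystem.component {M : CoxeterMatrix B} (cs : CoxeterSystem M W) (I : Set B)
    (i : B) : Set B :=
  {j | Relation.ReflTransGen (fun a b => a ∈ I ∧ b ∈ I ∧ cs.adjacent a b) i j}

/-- A subset `T` of `S` is connected if any two of its elements are joined by a path
within `T` in the Coxeter graph. -/
def CoxeterSystem.IsConnectedSubset {M : CoxeterMatrix B} (cs : CoxeterSystem M W)
    (T : Set B) : Prop :=
  ∀ a ∈ T, ∀ b ∈ T,
    Relation.ReflTransGen (fun x y => x ∈ T ∧ y ∈ T ∧ cs.adjacent x y) a b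

/-- A presentation `C = W_I w W_J` is minimal if `I` consists of left ascents of `w`, `J`
consists of right ascents of `w`, no connected component of `I` is contained in
`(w J w⁻¹) ∩ S`, and no connected component of `J` is contained in `(w⁻¹ I w) ∩ S`. -/
def CoxeterSystem.IsMinimalPresentation {M : CoxeterMatrix B} (cs : CoxeterSystem M W)
    (I : Set B) (w : W) (J : Set B) : Prop :=
  (∀ s ∈ I, cs.length w < cs.length (cs.simple s * w)) ∧
  (∀ s ∈ J, cs.length w < cs.length (w * cs.simple s)) ∧
  (∀ i ∈ I, ¬ (cs.component I i ⊆ {s : B | ∃ t ∈ J, cs.simple s = w * cs.simple t * w⁻¹})) ∧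
  (∀ j ∈ J, ¬ (cs.component J j ⊆ {s : B | ∃ t ∈ I, cs.simple s = w⁻¹ * cs.simple t * w}))

namespace CoxeterSystem

/-- The linear form `2 B(e_i, ·)` of the geometric representation. -/
noncomputable def coroot (M : CoxeterMatrix B) (i : B) : Module.Dual ℝ (B →₀ ℝ) :=
  Finsupp.linearCombination ℝ fun j => -2 * Real.cos (Real.pi / M i j)

theorem coroot_single (M : CoxeterMatrix B) (i j : B) :
    coroot M i (Finsupp.single j 1) = -2 * Real.cos (Real.pi / M i j) := by
  simp [coroot]

theorem coroot_self (M : CoxeterMatrix B) (i : B) :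
    coroot M i (Finsupp.single i 1) = 2 := by
  simp [coroot_single]

theorem reflection_mul_reflection_pow_eq_one {V : Type*} [AddCommGroup V] [Module ℝ V]
    {x y : V} {f g : Module.Dual ℝ V} (hf : f x = 2) (hg : g y = 2) {m : ℕ} (hm : 2 ≤ m)
    (hfy : f y = -2 * Real.cos (Real.pi / m)) (hgx : g x = -2 * Real.cos (Real.pi / m)) :
    (Module.reflection hf * Module.reflection hg) ^ m = 1 := by
  ext z
  rcases hm.eq_or_lt with rfl | hm
  · have h1 : f y = 0 := by simpa using hfy
    have h2 : g x = 0 := by simpa using hgx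
    simp only [pow_two, LinearEquiv.mul_apply, Module.reflection_apply, map_sub, map_smul, hf, hg,
      h1, h2, LinearEquiv.coe_one, id]
    module
  set θ : ℝ := 2 * (Real.pi / m) with hθ
  have hm0 : (m : ℝ) ≠ 0 := by positivity
  have hsin : Real.sin θ ≠ 0 := by
    refine (Real.sin_pos_of_pos_of_lt_pi (by positivity) ?_).ne'
    have : (2 : ℝ) < m := by exact_mod_cast hm
    rw [hθ, ← mul_div_assoc, div_lt_iff₀ (by positivity)]
    nlinarith [Real.pi_pos]
  have ht : 2 * Real.cos θ = f y * g x - 2 := by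
    rw [hfy, hgx, hθ, Real.cos_two_mul]
    ring
  rw [Module.reflection_mul_reflection_pow_apply hf hg m z _ ht]
  have hS (n : ℤ) := Polynomial.Chebyshev.S_two_mul_real_cos θ n
  obtain ⟨k, rfl | rfl⟩ := m.even_or_odd'
  · have h0 : (Polynomial.Chebyshev.S ℝ (k - 1)).eval (2 * Real.cos θ) = 0 := by
      refine (mul_eq_zero.1 ((hS (k - 1)).trans ?_)).resolve_right hsin
      rw [show (((k - 1 : ℤ) : ℝ) + 1) * θ = Real.pi by
        push_cast at hm0 ⊢
        rw [hθ]
        push_cast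
        field_simp [show (k : ℝ) ≠ 0 by simpa using hm0]
        ring, Real.sin_pi]
    rw [show (((2 * k : ℕ) : ℤ) - 2) / 2 = k - 1 by omega,
      show (((2 * k : ℕ) : ℤ) - 1) / 2 = k - 1 by omega]
    simp [h0]
  · have h0 : (Polynomial.Chebyshev.S ℝ k).eval (2 * Real.cos θ) +
        (Polynomial.Chebyshev.S ℝ (k - 1)).eval (2 * Real.cos θ) = 0 := by
      have hsum : Real.sin ((k + 1) * θ) + Real.sin (k * θ) = 0 := by
        have h1 : (k + 1) * θ = Real.pi + Real.pi / (2 * k + 1 : ℕ) := by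
          rw [hθ]
          push_cast at hm0 ⊢
          field_simp
          ring
        have h2 : k * θ = Real.pi - Real.pi / (2 * k + 1 : ℕ) := by
          rw [hθ]
          push_cast at hm0 ⊢
          field_simp
          ring
        rw [h1, h2, Real.sin_pi_sub, add_comm Real.pi, Real.sin_add_pi]
        ring
      refine (mul_eq_zero.1 (Eq.trans ?_ hsum)).resolve_right hsin
      rw [add_mul, hS, hS]
      push_cast
      ring_nf
    rw [show (((2 * k + 1 : ℕ) : ℤ) - 1) / 2 = k by omega,
      show (((2 * k + 1 : ℕ) : ℤ) - 3) / 2 = k - 1 by omega,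
      show ((2 * k + 1 : ℕ) : ℤ) / 2 = k by omega,
      show (((2 * k + 1 : ℕ) : ℤ) - 2) / 2 = k - 1 by omega]
    simp [h0]

theorem isLiftable_reflection (M : CoxeterMatrix B) :
    M.IsLiftable fun i => Module.reflection (coroot_self M i) := by
  intro i j
  rcases eq_or_ne i j with rfl | hij
  · rw [M.diagonal, pow_one]
    ext1 z
    exact Module.involutive_reflection (coroot_self M i) z
  · rcases Nat.eq_zero_or_pos (M i j) with h | h
    · rw [h, pow_zero]
    · have := M.off_diagonal i j hij
      exact reflection_mul_reflection_pow_eq_one _ _ (by omega) (coroot_single M i j)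
        (by rw [coroot_single, M.symmetric])

variable {M : CoxeterMatrix B} (cs : CoxeterSystem M W)

theorem simple_injective : Function.Injective cs.simple := by
  intro i j h
  by_contra hij
  have h1 := congrArg (fun g => cs.lift ⟨_, isLiftable_reflection M⟩ g (Finsupp.single i 1) i) h
  simp only [lift_apply_simple, Module.reflection_apply, coroot_self] at h1
  simp [Ne.symm hij] at h1

open Classical in
/-- The action of a simple reflection on pairs of a group element and a sign. -/
noncomputable def signedConj (i : B) : Function.End (W × ZMod 2) := fun p =>
  (cs.simple i * p.1 * cs.simple i, p.2 + if p.1 = cs.simple i then 1 else 0)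

open Classical in
theorem signedConj_mul_pow_apply (i j : B) (n : ℕ) (t : W) (ε : ZMod 2) :
    ((cs.signedConj i * cs.signedConj j) ^ n) (t, ε) =
      ((cs.simple i * cs.simple j) ^ n * t * ((cs.simple i * cs.simple j) ^ n)⁻¹,
        ε + ∑ l ∈ Finset.range (2 * n),
          if t = cs.simple j * (cs.simple i * cs.simple j) ^ l then 1 else 0) := by
  induction n with
  | zero => simp [show (1 : Function.End (W × ZMod 2)) (t, ε) = (t, ε) from rfl]
  | succ n ih =>
    have conj_eq (x u v : W) : x * u * x⁻¹ = v ↔ u = x⁻¹ * v * x := by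
      rw [mul_inv_eq_iff_eq_mul, ← eq_inv_mul_iff_mul_eq, mul_assoc]
    have hc : SemiconjBy (cs.simple j) (cs.simple i * cs.simple j)
        (cs.simple i * cs.simple j)⁻¹ := by
      simp [SemiconjBy, mul_assoc]
    have key : ((cs.simple i * cs.simple j) ^ n)⁻¹ * cs.simple j =
        cs.simple j * (cs.simple i * cs.simple j) ^ n := by
      rw [← inv_pow, (hc.pow_right n).eq]
    rw [pow_succ', show 2 * (n + 1) = 2 * n + 1 + 1 by ring, Finset.sum_range_succ,
      Finset.sum_range_succ]
    change cs.signedConj i (cs.signedConj j (((cs.signedConj i * cs.signedConj j) ^ n) (t, ε))) = _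
    rw [ih]
    have e1 : (cs.simple i * cs.simple j) ^ n * t * ((cs.simple i * cs.simple j) ^ n)⁻¹ =
        cs.simple j ↔ t = cs.simple j * (cs.simple i * cs.simple j) ^ (2 * n) := by
      rw [conj_eq, key, two_mul, pow_add, mul_assoc]
    have e2 : cs.simple j * ((cs.simple i * cs.simple j) ^ n * t *
        ((cs.simple i * cs.simple j) ^ n)⁻¹) * cs.simple j = cs.simple i ↔
        t = cs.simple j * (cs.simple i * cs.simple j) ^ (2 * n + 1) := by
      have h := conj_eq (cs.simple j) ((cs.simple i * cs.simple j) ^ n * t *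
        ((cs.simple i * cs.simple j) ^ n)⁻¹) (cs.simple i)
      rw [inv_simple] at h
      rw [h, conj_eq, mul_assoc (cs.simple j), ← mul_assoc _ (cs.simple j), key,
        show 2 * n + 1 = n + 1 + n by ring, pow_add _ (n + 1), pow_succ]
      simp only [mul_assoc]
    simp only [signedConj, e1, e2, add_assoc]
    congr 1
    rw [pow_succ']
    simp [mul_assoc]

theorem isLiftable_signedConj : M.IsLiftable cs.signedConj := by
  classical
  intro i j
  funext ⟨t, ε⟩
  rw [signedConj_mul_pow_apply, cs.simple_mul_simple_pow, two_mul, Finset.sum_range_add]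
  simp only [pow_add, cs.simple_mul_simple_pow, one_mul, CharTwo.add_self_eq_zero]
  simp [show (1 : Function.End (W × ZMod 2)) (t, ε) = (t, ε) from rfl]

open Classical in
theorem lift_signedConj_wordProd_apply (ω : List B) (t : W) (ε : ZMod 2) :
    cs.lift ⟨_, cs.isLiftable_signedConj⟩ (cs.wordProd ω) (t, ε) =
      (cs.wordProd ω * t * (cs.wordProd ω)⁻¹, ε + (cs.rightInvSeq ω).count t) := by
  induction ω with
  | nil => simp [show (1 : Function.End (W × ZMod 2)) (t, ε) = (t, ε) from rfl]
  | cons i ω ih =>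
    rw [wordProd_cons, map_mul, lift_apply_simple]
    change cs.signedConj i (cs.lift ⟨_, cs.isLiftable_signedConj⟩ (cs.wordProd ω) (t, ε)) = _
    rw [ih]
    have : (cs.wordProd ω)⁻¹ * cs.simple i * cs.wordProd ω = t ↔
        cs.wordProd ω * t * (cs.wordProd ω)⁻¹ = cs.simple i := by
      rw [mul_inv_eq_iff_eq_mul, mul_assoc, inv_mul_eq_iff_eq_mul, eq_comm]
    simp only [signedConj, rightInvSeq, List.count_cons, beq_iff_eq, this]
    simp [mul_assoc, add_assoc]

/-- The exchange property. -/
theorem exists_eraseIdx_of_isRightDescent {ω : List B} {i : B}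
    (h : cs.IsRightDescent (cs.wordProd ω) i) :
    ∃ k < ω.length, cs.wordProd ω * cs.simple i = cs.wordProd (ω.eraseIdx k) := by
  classical
  have hmem : cs.simple i ∈ cs.rightInvSeq ω := by
    by_contra hn
    obtain ⟨ψ, hψ, hψ'⟩ := cs.exists_isReduced (cs.wordProd ω * cs.simple i)
    have h1 := cs.lift_signedConj_wordProd_apply ψ (cs.simple i) 0
    have h2 := cs.lift_signedConj_wordProd_apply ω (cs.simple i) 1
    rw [List.count_eq_zero_of_not_mem hn] at h2
    have h3 : cs.simple i ∈ cs.rightInvSeq ψ := by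
      by_contra hn'
      rw [← hψ', map_mul, lift_apply_simple, List.count_eq_zero_of_not_mem hn'] at h1
      have h4 : cs.lift ⟨_, cs.isLiftable_signedConj⟩ (cs.wordProd ω)
        (cs.signedConj i (cs.simple i, 0)) = _ := h1
      simp only [signedConj, simple_mul_simple_self, one_mul, if_true, zero_add] at h4
      rw [h2] at h4
      simp at h4
    have h5 := (cs.isRightInversion_of_mem_rightInvSeq hψ h3).2
    rw [← hψ', simple_mul_simple_cancel_right] at h5
    exact lt_asymm h h5
  obtain ⟨k, hk, hk'⟩ := List.mem_iff_getElem.1 hmem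
  refine ⟨k, by simpa using hk, ?_⟩
  rw [← wordProd_mul_getD_rightInvSeq, List.getD_eq_getElem _ 1 hk, hk']

theorem parabolic_mono {I J : Set B} (h : I ⊆ J) : cs.parabolic I ≤ cs.parabolic J :=
  Subgroup.closure_mono (Set.image_mono h)

theorem simple_mem_parabolic {I : Set B} {i : B} (h : i ∈ I) : cs.simple i ∈ cs.parabolic I :=
  Subgroup.subset_closure ⟨i, h, rfl⟩

theorem wordProd_mem_parabolic {I : Set B} {ω : List B} (h : ∀ i ∈ ω, i ∈ I) :
    cs.wordProd ω ∈ cs.parabolic I :=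
  Subgroup.list_prod_mem _ fun x hx => by
    obtain ⟨i, hi, rfl⟩ := List.mem_map.1 hx
    exact cs.simple_mem_parabolic (h i hi)

/-- An element of a parabolic subgroup has a reduced word in the generators of that subgroup. -/
theorem exists_isReduced_of_mem_parabolic {I : Set B} {w : W} (hw : w ∈ cs.parabolic I) :
    ∃ ω : List B, cs.IsReduced ω ∧ cs.wordProd ω = w ∧ ∀ i ∈ ω, i ∈ I := by
  have step (w : W) (i : B) (hi : i ∈ I)
      (h : ∃ ω : List B, cs.IsReduced ω ∧ cs.wordProd ω = w ∧ ∀ i ∈ ω, i ∈ I) :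
      ∃ ω : List B, cs.IsReduced ω ∧ cs.wordProd ω = w * cs.simple i ∧ ∀ i ∈ ω, i ∈ I := by
    obtain ⟨ω, hω, rfl, hI⟩ := h
    by_cases hd : cs.IsRightDescent (cs.wordProd ω) i
    · obtain ⟨k, hk, hk'⟩ := cs.exists_eraseIdx_of_isRightDescent hd
      refine ⟨ω.eraseIdx k, ?_, hk'.symm, fun i hi => hI i (List.mem_of_mem_eraseIdx hi)⟩
      have h1 := cs.isRightDescent_iff.1 hd
      have h2 := List.length_eraseIdx_add_one hk
      rw [hk', hω.eq] at h1
      unfold IsReduced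
      omega
    · refine ⟨ω ++ [i], ?_, by simp [wordProd_append], ?_⟩
      · have h1 := cs.not_isRightDescent_iff.1 hd
        rw [hω.eq] at h1
        simpa [IsReduced, wordProd_append] using h1
      · intro j hj
        rcases List.mem_append.1 hj with hj | hj
        · exact hI j hj
        · rwa [List.mem_singleton.1 hj]
  induction hw using Subgroup.closure_induction_right with
  | one => exact ⟨[], by simp [IsReduced], by simp, by simp⟩
  | mul_right x hx y hy ih =>
    obtain ⟨i, hi, rfl⟩ := hy
    exact step x i hi ih
  | mul_inv_cancel x hx y hy ih =>
    obtain ⟨i, hi, rfl⟩ := hy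
    rw [inv_simple]
    exact step x i hi ih

theorem simple_mem_parabolic_iff {I : Set B} {i : B} : cs.simple i ∈ cs.parabolic I ↔ i ∈ I := by
  refine ⟨fun h => ?_, cs.simple_mem_parabolic⟩
  obtain ⟨ω, hω, hω', hI⟩ := cs.exists_isReduced_of_mem_parabolic h
  have hl := hω.eq
  rw [hω', length_simple] at hl
  obtain ⟨j, rfl⟩ := List.length_eq_one_iff.1 hl.symm
  rw [wordProd_singleton] at hω'
  rw [← cs.simple_injective hω']
  exact hI j (by simp)

theorem mem_of_isRightDescent_of_mem_parabolic {I : Set B} {w : W} (hw : w ∈ cs.parabolic I)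
    {i : B} (hi : cs.IsRightDescent w i) : i ∈ I := by
  obtain ⟨ω, -, rfl, hI⟩ := cs.exists_isReduced_of_mem_parabolic hw
  obtain ⟨k, -, hk⟩ := cs.exists_eraseIdx_of_isRightDescent hi
  rw [← cs.simple_mem_parabolic_iff, ← Subgroup.mul_mem_cancel_left _ hw, hk]
  exact cs.wordProd_mem_parabolic fun i hi => hI i (List.mem_of_mem_eraseIdx hi)

/-- If no element of `w W_I` is shorter than `w`, then lengths add in `w W_I`. -/
theorem length_mul_of_minimal {I : Set B} {w : W}
    (hw : ∀ y ∈ cs.parabolic I, cs.length w ≤ cs.length (w * y)) {y : W}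
    (hy : y ∈ cs.parabolic I) : cs.length (w * y) = cs.length w + cs.length y := by
  obtain ⟨ψ, hψ, rfl, hI⟩ := cs.exists_isReduced_of_mem_parabolic hy
  obtain ⟨ω, hω, rfl⟩ := cs.exists_isReduced w
  clear hy
  induction ψ using List.reverseRecOn with
  | nil => simp
  | append_singleton ψ i ih =>
    have hψ' : cs.IsReduced ψ := by simpa using hψ.take ψ.length
    have ih := ih hψ' fun j hj => hI j (List.mem_append_left _ hj)
    have hψi := hψ.eq
    rw [hψ.eq, List.length_append, List.length_singleton, ← add_assoc, ← hψ'.eq, ← ih,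
      wordProd_append, wordProd_singleton, ← mul_assoc]
    refine (cs.length_mul_simple _ i).resolve_right fun hlt => ?_
    have hd : cs.IsRightDescent (cs.wordProd (ω ++ ψ)) i := by
      rw [IsRightDescent, wordProd_append]
      omega
    obtain ⟨k, hk, hk'⟩ := cs.exists_eraseIdx_of_isRightDescent hd
    rcases lt_or_ge k ω.length with hkω | hkω
    · rw [List.eraseIdx_append_of_lt_length hkω, wordProd_append, wordProd_append] at hk'
      have h1 := hw (cs.wordProd ψ * cs.simple i * (cs.wordProd ψ)⁻¹) <|
        mul_mem (mul_mem (cs.wordProd_mem_parabolic fun j hj => hI j (List.mem_append_left _ hj))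
          (cs.simple_mem_parabolic (hI i (by simp))))
          (inv_mem (cs.wordProd_mem_parabolic fun j hj => hI j (List.mem_append_left _ hj)))
      rw [← mul_assoc, ← mul_assoc, hk', mul_inv_cancel_right, hω.eq] at h1
      have h2 := cs.length_wordProd_le (ω.eraseIdx k)
      have h3 := List.length_eraseIdx_add_one hkω
      omega
    · rw [List.eraseIdx_append_of_length_le hkω, wordProd_append, wordProd_append, mul_assoc,
        mul_right_inj, ← wordProd_singleton, ← wordProd_append] at hk'
      rw [hk'] at hψi
      have h2 := cs.length_wordProd_le (ψ.eraseIdx (k - ω.length))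
      have h3 := List.length_eraseIdx_le ψ (k - ω.length)
      simp at hψi
      omega

theorem length_mul_of_mem_parabolic_right {I : Set B} {w : W}
    (hw : ∀ i ∈ I, ¬ cs.IsRightDescent w i) {y : W} (hy : y ∈ cs.parabolic I) :
    cs.length (w * y) = cs.length w + cs.length y := by
  obtain ⟨z, hz, hmin⟩ : ∃ z ∈ cs.parabolic I, ∀ y ∈ cs.parabolic I,
      cs.length (w * z) ≤ cs.length (w * y) :=
    exists_minimalFor_of_wellFoundedLT (· ∈ cs.parabolic I) (fun y => cs.length (w * y))
      ⟨1, one_mem _⟩ |>.imp fun z hz => ⟨hz.1, fun y hy => (le_total _ _).elim id (hz.2 hy)⟩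
  have hadd {y : W} (hy : y ∈ cs.parabolic I) :
      cs.length (w * z * y) = cs.length (w * z) + cs.length y :=
    cs.length_mul_of_minimal (fun y hy => by
      rw [mul_assoc]
      exact hmin _ (mul_mem hz hy)) hy
  obtain rfl : z = 1 := by
    by_contra hne
    obtain ⟨i, hi⟩ := cs.exists_rightDescent_of_ne_one (inv_ne_one.2 hne)
    have hiI := cs.mem_of_isRightDescent_of_mem_parabolic (inv_mem hz) hi
    refine hw i hiI ?_
    have h1 := hadd (inv_mem hz)
    have h2 := hadd (mul_mem (inv_mem hz) (cs.simple_mem_parabolic hiI))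
    rw [← mul_assoc, mul_inv_cancel_right] at h2
    rw [mul_inv_cancel_right] at h1
    unfold IsRightDescent at hi ⊢
    omega
  simpa using hadd hy

theorem length_mul_of_mem_parabolic_left {I : Set B} {w : W}
    (hw : ∀ i ∈ I, ¬ cs.IsLeftDescent w i) {x : W} (hx : x ∈ cs.parabolic I) :
    cs.length (x * w) = cs.length x + cs.length w := by
  have := cs.length_mul_of_mem_parabolic_right (w := w⁻¹)
    (fun i hi => by simpa [isRightDescent_inv_iff] using hw i hi) (inv_mem hx)
  rwa [← mul_inv_rev, length_inv, length_inv, length_inv, add_comm] at this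

/-- A right descent `j` of `u w`, where `u ∈ W_I` and `w` is reduced on the left with respect
to `I`, is either a right descent of `w` or comes from a right descent of `u`. -/
theorem exists_isRightDescent_of_mul {I : Set B} {w u : W} {j : B}
    (hw : ∀ i ∈ I, ¬ cs.IsLeftDescent w i) (hj : ¬ cs.IsRightDescent w j)
    (hu : u ∈ cs.parabolic I) (h : cs.IsRightDescent (u * w) j) :
    ∃ i ∈ I, cs.IsRightDescent u i ∧ w * cs.simple j = cs.simple i * w := by
  obtain ⟨ψ, hψ, rfl, hI⟩ := cs.exists_isReduced_of_mem_parabolic hu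
  obtain ⟨ω, hω, rfl⟩ := cs.exists_isReduced w
  rw [← wordProd_append] at h
  obtain ⟨k, hk, hk'⟩ := cs.exists_eraseIdx_of_isRightDescent h
  rcases lt_or_ge k ψ.length with hkψ | hkψ
  · rw [List.eraseIdx_append_of_lt_length hkψ, wordProd_append, wordProd_append] at hk'
    have hu' : cs.wordProd (ψ.eraseIdx k) ∈ cs.parabolic I :=
      cs.wordProd_mem_parabolic fun i hi => hI i (List.mem_of_mem_eraseIdx hi)
    have hr : (cs.wordProd ψ)⁻¹ * cs.wordProd (ψ.eraseIdx k) ∈ cs.parabolic I :=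
      mul_mem (inv_mem hu) hu'
    have hwj : cs.wordProd ω * cs.simple j =
        (cs.wordProd ψ)⁻¹ * cs.wordProd (ψ.eraseIdx k) * cs.wordProd ω := by
      rw [mul_assoc _ (cs.wordProd (ψ.eraseIdx k)), ← hk']
      group
    have hl := cs.length_mul_of_mem_parabolic_left hw hr
    rw [← hwj, cs.not_isRightDescent_iff.1 hj, add_comm, add_right_cancel_iff] at hl
    obtain ⟨i, hi⟩ := cs.length_eq_one_iff.1 hl.symm
    rw [hi] at hr hwj
    refine ⟨i, cs.simple_mem_parabolic_iff.1 hr, ?_, hwj⟩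
    rw [IsRightDescent, ← hi, mul_inv_cancel_left, hψ.eq]
    have h2 := cs.length_wordProd_le (ψ.eraseIdx k)
    have h3 := List.length_eraseIdx_add_one hkψ
    omega
  · rw [List.eraseIdx_append_of_length_le hkψ, wordProd_append, wordProd_append, mul_assoc,
      mul_right_inj] at hk'
    refine absurd ?_ hj
    rw [List.length_append] at hk
    have h2 := cs.length_wordProd_le (ω.eraseIdx (k - ψ.length))
    have h3 := List.length_eraseIdx_add_one (show k - ψ.length < ω.length by omega)
    rw [IsRightDescent, hk', hω.eq]
    omega

/-- Every element of `W_I w W_J` can be written as `u w v` with `u w` reduced on the right with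
respect to `J`. -/
theorem exists_reduced_left_factor {I J : Set B} {w : W}
    (hI : ∀ i ∈ I, ¬ cs.IsLeftDescent w i) (hJ : ∀ j ∈ J, ¬ cs.IsRightDescent w j) {u v : W}
    (hu : u ∈ cs.parabolic I) (hv : v ∈ cs.parabolic J) :
    ∃ u' ∈ cs.parabolic I, ∃ v' ∈ cs.parabolic J, u * w * v = u' * w * v' ∧
      ∀ j ∈ J, ¬ cs.IsRightDescent (u' * w) j := by
  induction h : cs.length u using Nat.strong_induction_on generalizing u v with
  | _ n ih =>
    by_cases hd : ∀ j ∈ J, ¬ cs.IsRightDescent (u * w) j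
    · exact ⟨u, hu, v, hv, rfl, hd⟩
    · push Not at hd
      obtain ⟨j, hj, hd⟩ := hd
      obtain ⟨i, hi, hui, hij⟩ := cs.exists_isRightDescent_of_mul hI (hJ j hj) hu hd
      obtain ⟨u', hu', v', hv', he, h'⟩ := ih _ (h ▸ hui)
        (mul_mem hu (cs.simple_mem_parabolic hi)) (mul_mem (cs.simple_mem_parabolic hj) hv) rfl
      refine ⟨u', hu', v', hv', ?_, h'⟩
      rw [← he, mul_assoc u (cs.simple i), ← hij]
      simp [mul_assoc]

/-- An element `w` without left descents in `I` and right descents in `J` is of minimal length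
in `W_I w W_J`. -/
theorem length_le_of_mem_doubleCoset {I J : Set B} {w x : W}
    (hI : ∀ i ∈ I, ¬ cs.IsLeftDescent w i) (hJ : ∀ j ∈ J, ¬ cs.IsRightDescent w j)
    (hx : x ∈ cs.doubleCoset I w J) : cs.length w ≤ cs.length x := by
  obtain ⟨u, hu, v, hv, rfl⟩ := hx
  obtain ⟨u', hu', v', hv', he, h'⟩ := cs.exists_reduced_left_factor hI hJ hu hv
  rw [he, cs.length_mul_of_mem_parabolic_right h' hv',
    cs.length_mul_of_mem_parabolic_left hI hu']
  omega

/-- If `x ∈ W_L` has no right descent in `(w J w⁻¹) ∩ S` and `x w ∈ W_I w W_J`,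
then `x ∈ W_I`. -/
theorem mem_parabolic_of_mul_mem_doubleCoset {I J L : Set B} {w x : W} (hIL : I ⊆ L)
    (hL : ∀ i ∈ L, ¬ cs.IsLeftDescent w i) (hJ : ∀ j ∈ J, ¬ cs.IsRightDescent w j)
    (hx : x ∈ cs.parabolic L)
    (hxd : ∀ s, cs.IsRightDescent x s → ¬ ∃ t ∈ J, cs.simple s = w * cs.simple t * w⁻¹)
    (h : x * w ∈ cs.doubleCoset I w J) : x ∈ cs.parabolic I := by
  obtain ⟨u, hu, v, hv, he⟩ := h
  obtain ⟨u', hu', v', hv', he', h'⟩ :=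
    cs.exists_reduced_left_factor (fun i hi => hL i (hIL hi)) hJ hu hv
  rw [he'] at he
  have hxw (j : B) (hj : j ∈ J) : ¬ cs.IsRightDescent (x * w) j := fun hd => by
    obtain ⟨i, -, hxi, hij⟩ := cs.exists_isRightDescent_of_mul hL (hJ j hj) hx hd
    exact hxd i hxi ⟨j, hj, by rw [hij, mul_inv_cancel_right]⟩
  have h1 := cs.length_mul_of_mem_parabolic_right h' hv'
  have h2 := cs.length_mul_of_mem_parabolic_right hxw (inv_mem hv')
  rw [he, mul_inv_cancel_right, length_inv] at h2
  obtain rfl : v' = 1 := cs.length_eq_zero_iff.1 (by omega)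
  rw [mul_one, mul_left_inj] at he
  rwa [he]

/-- If `x ∈ W_X` has `c` as its only right descent and `d ∉ X` is adjacent to `c`, then `d` is
the only right descent of `x d`. -/
theorem eq_of_isRightDescent_mul_simple {X : Set B} {c d : B} (hc : c ∈ X) (hd : d ∉ X)
    (hcd : cs.adjacent c d) {x : W} (hx : x ∈ cs.parabolic X)
    (hxc : ∀ s, cs.IsRightDescent x s → s = c) {s : B}
    (hs : cs.IsRightDescent (x * cs.simple d) s) : s = d := by
  by_contra hsd
  have hleft : ∀ i ∈ X, ¬ cs.IsLeftDescent (cs.simple d) i := fun i hi h => hd <| by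
    have h' : cs.IsRightDescent (cs.simple d) i := by
      rwa [← isLeftDescent_inv_iff, inv_simple]
    rwa [← Set.mem_singleton_iff.1 (cs.mem_of_isRightDescent_of_mem_parabolic (I := {d})
      (cs.simple_mem_parabolic rfl) h')]
  have hright : ¬ cs.IsRightDescent (cs.simple d) s := fun h =>
    hsd (cs.mem_of_isRightDescent_of_mem_parabolic (I := {d}) (cs.simple_mem_parabolic rfl) h)
  obtain ⟨i, -, hi, hdi⟩ := cs.exists_isRightDescent_of_mul hleft hright hx hs
  obtain rfl := hxc i hi
  have hmem : cs.simple s ∈ cs.parabolic {i, d} := by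
    rw [← cs.simple_mul_simple_cancel_left (w := cs.simple s) d, hdi]
    have h1 := cs.simple_mem_parabolic (I := {i, d}) (i := i) (by simp)
    have h2 := cs.simple_mem_parabolic (I := {i, d}) (i := d) (by simp)
    exact mul_mem h2 (mul_mem h1 h2)
  obtain rfl : s = i := (cs.simple_mem_parabolic_iff.1 hmem).resolve_right hsd
  exact hcd.2 hdi.symm

/-- Along a path from `t ∉ I` through elements of `I` there are elements of `W_{I ∪ {t}}` outside
`W_I` whose only right descent is the endpoint of the path. -/
theorem exists_unique_isRightDescent {I : Set B} {t i a : B} (ht : t ∉ I) (hi : i ∈ I)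
    (hti : cs.adjacent t i)
    (h : Relation.ReflTransGen (fun a b => a ∈ I ∧ b ∈ I ∧ cs.adjacent a b) i a) :
    ∃ x ∈ cs.parabolic (insert t I), x ∉ cs.parabolic I ∧
      ∀ s, cs.IsRightDescent x s → s = a := by
  let P (X : Set B) : Prop := ∀ c ∈ X, ∃ x ∈ cs.parabolic X, x ∉ cs.parabolic I ∧
    ∀ s, cs.IsRightDescent x s → s = c
  have extend {X : Set B} {c d : B} (hX : X ⊆ insert t I) (hP : P X) (hc : c ∈ X) (hd : d ∈ I)
      (hcd : cs.adjacent c d) : ∃ Y ⊆ insert t I, P Y ∧ d ∈ Y := by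
    by_cases hdX : d ∈ X
    · exact ⟨X, hX, hP, hdX⟩
    refine ⟨insert d X, Set.insert_subset (Or.inr hd) hX, ?_, Set.mem_insert _ _⟩
    have hle := cs.parabolic_mono (Set.subset_insert d X)
    rintro e (rfl | he)
    · obtain ⟨x, hx, hxI, hxc⟩ := hP c hc
      refine ⟨x * cs.simple e,
        mul_mem (hle hx) (cs.simple_mem_parabolic (Set.mem_insert _ _)), ?_,
        fun s => cs.eq_of_isRightDescent_mul_simple hc hdX hcd hx hxc⟩
      rwa [Subgroup.mul_mem_cancel_right _ (cs.simple_mem_parabolic hd)]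
    · obtain ⟨x, hx, hx'⟩ := hP e he
      exact ⟨x, hle hx, hx'⟩
  have hPt : P {t} := by
    rintro c rfl
    exact ⟨cs.simple c, cs.simple_mem_parabolic rfl, fun h => ht (cs.simple_mem_parabolic_iff.1 h),
      fun s hs => cs.mem_of_isRightDescent_of_mem_parabolic (I := {c})
        (cs.simple_mem_parabolic rfl) hs⟩
  obtain ⟨X, hX, hP, ha⟩ : ∃ X ⊆ insert t I, P X ∧ a ∈ X := by
    induction h with
    | refl => exact extend (by simp) hPt rfl hi hti
    | tail _ hbc ih =>
      obtain ⟨X, hX, hP, hb⟩ := ih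
      exact extend hX hP hb hbc.2.1 hbc.2.2
  obtain ⟨x, hx, hx'⟩ := hP a ha
  exact ⟨x, cs.parabolic_mono hX hx, hx'⟩

theorem mul_mem_doubleCoset {I J : Set B} {w u x : W} (hu : u ∈ cs.parabolic I)
    (hx : x ∈ cs.doubleCoset I w J) : u * x ∈ cs.doubleCoset I w J := by
  obtain ⟨a, ha, b, hb, rfl⟩ := hx
  exact ⟨u * a, mul_mem hu ha, b, hb, by simp only [mul_assoc]⟩

theorem mem_doubleCoset_self (I J : Set B) (w : W) : w ∈ cs.doubleCoset I w J :=
  ⟨1, one_mem _, 1, one_mem _, by simp⟩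

/-- If left multiplication by the generators in `L` preserves `C`, so does `W_L`. -/
theorem mul_mem_of_mem_parabolic {L : Set B} {C : Set W}
    (hL : ∀ i ∈ L, ∀ x ∈ C, cs.simple i * x ∈ C) {u x : W} (hu : u ∈ cs.parabolic L)
    (hx : x ∈ C) : u * x ∈ C := by
  obtain ⟨ω, -, rfl, hω⟩ := cs.exists_isReduced_of_mem_parabolic hu
  clear hu
  induction ω with
  | nil => simpa
  | cons i ω ih =>
    rw [wordProd_cons, mul_assoc]
    exact hL i (hω i (by simp)) _ (ih fun j hj => hω j (by simp [hj]))

end CoxeterSystem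

/-- If `C = W_I w W_J` is a minimal presentation and `T ⊆ M_L(C)` is connected in the
Coxeter graph, then either `T ⊆ I`, or `T` is disjoint from and non-adjacent to `I`
and `T ⊆ (w J w⁻¹) ∩ S`. -/
theorem connected_subset_of_ML
    [Fintype B] {M : CoxeterMatrix B} (cs : CoxeterSystem M W)
    (I J : Set B) (w : W) (C : Set W)
    (hC : C = cs.doubleCoset I w J)
    (hmin : cs.IsMinimalPresentation I w J)
    (T : Set B)
    (hT : T ⊆ {s : B | ∃ (I' J' : Set B) (w' : W), C = cs.doubleCoset I' w' J' ∧ s ∈ I'})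
    (hconn : cs.IsConnectedSubset T) :
    T ⊆ I ∨
      (Disjoint T I ∧ (∀ t ∈ T, ∀ i ∈ I, ¬ cs.adjacent t i) ∧
        T ⊆ {s : B | ∃ t ∈ J, cs.simple s = w * cs.simple t * w⁻¹}) := by
  have hJ : ∀ j ∈ J, ¬ cs.IsRightDescent w j := fun j hj h => lt_asymm h (hmin.2.1 j hj)
  have hI : ∀ i ∈ I, ¬ cs.IsLeftDescent w i := fun i hi h => lt_asymm h (hmin.1 i hi)
  have hstabI : ∀ i ∈ I, ∀ x ∈ C, cs.simple i * x ∈ C := by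
    subst hC
    exact fun i hi x hx => cs.mul_mem_doubleCoset (cs.simple_mem_parabolic hi) hx
  have hstabT : ∀ t ∈ T, ∀ x ∈ C, cs.simple t * x ∈ C := by
    intro t ht x hx
    obtain ⟨I', J', w', hC', htI'⟩ := hT ht
    rw [hC'] at hx ⊢
    exact cs.mul_mem_doubleCoset (cs.simple_mem_parabolic htI') hx
  have hwC : w ∈ C := hC ▸ cs.mem_doubleCoset_self I J w
  have main {t : B} (ht : t ∈ T) {x : W} (hx : x ∈ cs.parabolic (insert t I))
      (hxd : ∀ s, cs.IsRightDescent x s → ¬ ∃ j ∈ J, cs.simple s = w * cs.simple j * w⁻¹) :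
      x ∈ cs.parabolic I := by
    have hstab : ∀ i ∈ insert t I, ∀ x ∈ C, cs.simple i * x ∈ C := by
      rintro i (rfl | hi)
      exacts [hstabT i ht, hstabI i hi]
    refine cs.mem_parabolic_of_mul_mem_doubleCoset (Set.subset_insert t I) (fun i hi h => ?_) hJ
      hx hxd (hC ▸ cs.mul_mem_of_mem_parabolic hstab hx hwC)
    exact h.not_ge (cs.length_le_of_mem_doubleCoset hI hJ (hC ▸ hstab i hi w hwC))
  have hadj {t i : B} (ht : t ∈ T) (htI : t ∉ I) (hi : i ∈ I) : ¬ cs.adjacent t i := by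
    intro hti
    obtain ⟨a, hia, ha⟩ := Set.not_subset.1 (hmin.2.2.1 i hi)
    obtain ⟨x, hx, hxI, hxa⟩ := cs.exists_unique_isRightDescent htI hi hti hia
    exact hxI (main ht hx fun s hs => hxa s hs ▸ ha)
  rw [or_iff_not_imp_left, Set.not_subset]
  rintro ⟨t₀, ht₀, ht₀I⟩
  have hdisj {t : B} (ht : t ∈ T) : t ∉ I := by
    induction hconn t₀ ht₀ t ht with
    | refl => exact ht₀I
    | tail _ hbc ih => exact fun hcI => hadj hbc.1 (ih hbc.1) hcI hbc.2.2
  refine ⟨Set.disjoint_left.2 fun t ht => hdisj ht, fun t ht i hi => hadj ht (hdisj ht) hi,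
    fun t ht => ?_⟩
  by_contra hK
  refine hdisj ht (cs.simple_mem_parabolic_iff.1 (main ht
    (cs.simple_mem_parabolic (Set.mem_insert t I)) fun s hs => ?_))
  obtain rfl : s = t := cs.mem_of_isRightDescent_of_mem_parabolic (I := {t})
    (cs.simple_mem_parabolic rfl) hs
  exact hK
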